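/- arXiv:2502.05839 — 2 statements merged into one kernel-verified Lean document; each statement's English description precedes it below -/
import Mathlib

section
/- Assume μ₊ > 0, μ₋ > 0, and that one of the following holds: (c₊ > 0 and 0 < a₂ ≤ a ≤ a₁), or (c₊ > 0 and 0 < a₃ ≤ a ≤ min(a₁,a₂)), or (c₊ ≤ 0, Θ > 0 and 0 < a₃ ≤ a ≤ a₁). Define ι(u) := inf{z ∈ [0,a] : g'(z) ≤ u} and φ(x) := ψ(ι(g'(x)), x) for x ≥ a. Then there exists a unique z₂ ∈ (a,∞) with φ(z₂) = β, and M_ζ = {(ι(g'(z₂)), z₂)}. -/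
open Real Set Filter

lemma hasDerivAt_ite_lt {a : ℝ} {f₁ f₂ d₁ d₂ : ℝ → ℝ} (h₁ : ∀ x, HasDerivAt f₁ (d₁ x) x)
    (h₂ : ∀ x, HasDerivAt f₂ (d₂ x) x) (hf : f₁ a = f₂ a) (hd : d₁ a = d₂ a) (x : ℝ) :
    HasDerivAt (fun x => if a < x then f₁ x else f₂ x) (if a < x then d₁ x else d₂ x) x := by
  rcases lt_trichotomy x a with h | h | h
  · rw [if_neg (not_lt.2 h.le)]
    refine (h₂ x).congr_of_eventuallyEq ?_
    filter_upwards [Iio_mem_nhds h] with y hy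
    rw [if_neg (not_lt.2 (le_of_lt hy))]
  · subst h
    rw [if_neg (lt_irrefl _)]
    have hr : HasDerivWithinAt (fun y => if x < y then f₁ y else f₂ y) (d₂ x) (Ici x) x := by
      rw [← hd]
      refine (h₁ x).hasDerivWithinAt.congr (fun y hy => ?_) (by simp [hf])
      rcases eq_or_lt_of_le (mem_Ici.1 hy) with rfl | hy
      · simp [hf]
      · simp [hy]
    have hl : HasDerivWithinAt (fun y => if x < y then f₁ y else f₂ y) (d₂ x) (Iic x) x :=
      (h₂ x).hasDerivWithinAt.congr (fun y hy => if_neg (not_lt.2 hy)) (by simp)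
    simpa [hasDerivWithinAt_univ] using hl.union hr
  · rw [if_pos h]
    refine (h₁ x).congr_of_eventuallyEq ?_
    filter_upwards [Ioi_mem_nhds h] with y hy
    rw [if_pos (mem_Ioi.1 hy)]

/-- `i` is the first point of `[0, a]` where `d` is at most `d x`, for `d` decreasing on `[0, a]`
and increasing afterwards. -/
lemma sInf_sublevel_spec {a : ℝ} (ha : 0 < a) {d : ℝ → ℝ} (hdc : Continuous d)
    (hanti : StrictAntiOn d (Icc 0 a)) (hmono : StrictMonoOn d (Ici a)) {x i : ℝ} (hx : a ≤ x)
    (hi : i = sInf {z | z ∈ Icc 0 a ∧ d z ≤ d x}) :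
    0 ≤ i ∧ i ≤ a ∧ (∀ s, 0 ≤ s → s < i → d x < d s) ∧ (∀ s, i < s → s < x → d s < d x) := by
  set S := {z | z ∈ Icc 0 a ∧ d z ≤ d x}
  have haS : a ∈ S := ⟨⟨ha.le, le_rfl⟩, hmono.monotoneOn self_mem_Ici hx hx⟩
  have hbdd : BddBelow S := ⟨0, fun z hz => hz.1.1⟩
  have hcl : IsClosed S := isClosed_Icc.inter (isClosed_le hdc continuous_const)
  have hiS : i ∈ S := hi ▸ hcl.csInf_mem ⟨a, haS⟩ hbdd
  refine ⟨hiS.1.1, hiS.1.2, fun s hs hsi => ?_, fun s his hsx => ?_⟩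
  · by_contra! h
    exact absurd (hi ▸ csInf_le hbdd ⟨⟨hs, hsi.le.trans hiS.1.2⟩, h⟩ : i ≤ s) (not_le.2 hsi)
  · rcases le_total s a with h | h
    · exact (hanti hiS.1 ⟨hiS.1.1.trans his.le, h⟩ his).trans_le hiS.2
    · exact hmono h hx hsx

lemma sub_div_deriv_max {i x : ℝ} {g d : ℝ → ℝ} (hg : ∀ x, HasDerivAt g (d x) x)
    (hix : i ≤ x) (hdx : 0 < d x)
    (hlt : ∀ s, 0 ≤ s → s < i → d x < d s) (hmid : ∀ s, i < s → s < x → d s < d x)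
    (hgt : ∀ s, x < s → d x < d s) {z y : ℝ} (hz : 0 ≤ z) (hzy : z ≤ y) :
    y - z - (g y - g z) / d x ≤ x - i - (g x - g i) / d x ∧
      (i < x → y - z - (g y - g z) / d x = x - i - (g x - g i) / d x → z = i ∧ y = x) := by
  set H : ℝ → ℝ := fun t => t - g t / d x
  have hH : ∀ t, HasDerivAt H (1 - d t / d x) t := fun t => (hasDerivAt_id t).sub ((hg t).div_const _)
  have hc : Continuous H := continuous_iff_continuousAt.2 fun t => (hH t).continuousAt
  have h₁ : StrictAntiOn H (Icc 0 i) := by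
    refine strictAntiOn_of_deriv_neg (convex_Icc _ _) hc.continuousOn fun t ht => ?_
    rw [interior_Icc] at ht
    rw [(hH t).deriv, sub_neg, one_lt_div hdx]
    exact hlt t ht.1.le ht.2
  have h₂ : StrictMonoOn H (Icc i x) := by
    refine strictMonoOn_of_deriv_pos (convex_Icc _ _) hc.continuousOn fun t ht => ?_
    rw [interior_Icc] at ht
    rw [(hH t).deriv, sub_pos, div_lt_one hdx]
    exact hmid t ht.1 ht.2
  have h₃ : StrictAntiOn H (Ici x) := by
    refine strictAntiOn_of_deriv_neg (convex_Ici _) hc.continuousOn fun t ht => ?_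
    rw [interior_Ici] at ht
    rw [(hH t).deriv, sub_neg, one_lt_div hdx]
    exact hgt t ht
  have e : ∀ u v, v - u - (g v - g u) / d x = H v - H u := fun u v => by simp only [H]; ring
  rw [e, e]
  have hlow : ∀ t, 0 ≤ t → t ≤ x → t ≠ i → H i < H t := fun t h0 hx hne => by
    rcases lt_or_gt_of_ne hne with h | h
    · exact h₁ ⟨h0, h.le⟩ ⟨h0.trans h.le, le_rfl⟩ h
    · exact h₂ ⟨le_rfl, hix⟩ ⟨h.le, hx⟩ h
  have hup : ∀ t, i ≤ t → t ≠ x → H t < H x := fun t hi hne => by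
    rcases lt_or_gt_of_ne hne with h | h
    · exact h₂ ⟨hi, h.le⟩ ⟨hix, le_rfl⟩ h
    · exact h₃ self_mem_Ici h.le h
  have hxi : H i ≤ H x := h₂.monotoneOn ⟨le_rfl, hix⟩ ⟨hix, le_rfl⟩ hix
  have hxi' : i < x → H i < H x := fun h => h₂ ⟨le_rfl, hix⟩ ⟨hix, le_rfl⟩ h
  rcases lt_or_ge x z with hxz | hzx
  · have : H y ≤ H z := h₃.antitoneOn hxz.le (hxz.le.trans hzy) hzy
    exact ⟨by linarith, fun h h' => by linarith [hxi' h]⟩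
  rcases lt_or_ge y i with hyi | hiy
  · have : H y ≤ H z := h₁.antitoneOn ⟨hz, hzy.trans hyi.le⟩ ⟨hz.trans hzy, hyi.le⟩ hzy
    exact ⟨by linarith, fun h h' => by linarith [hxi' h]⟩
  have hz' : H i ≤ H z := by
    rcases eq_or_ne z i with rfl | h
    · rfl
    · exact (hlow z hz hzx h).le
  have hy' : H y ≤ H x := by
    rcases eq_or_ne y x with rfl | h
    · rfl
    · exact (hup y hiy h).le
  refine ⟨by linarith, fun _ h => ⟨?_, ?_⟩⟩
  · by_contra hne
    linarith [hlow z hz hzx hne]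
  · by_contra hne
    linarith [hup y hiy hne]

theorem existsUnique_maximizer_of_strictAnti_strictMono_deriv
    {a β : ℝ} (ha : 0 < a) (hβ : 0 < β) {g d : ℝ → ℝ}
    (hg : ∀ x, HasDerivAt g (d x) x) (hdc : Continuous d) (hpos : ∀ x, 0 ≤ x → 0 < d x)
    (hanti : StrictAntiOn d (Icc 0 a)) (hmono : StrictMonoOn d (Ici a))
    (htop : Tendsto d atTop atTop)
    {D : Set (ℝ × ℝ)} (hD : D = {p : ℝ × ℝ | 0 ≤ p.1 ∧ 0 ≤ p.2 ∧ p.1 + β ≤ p.2})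
    {ζ : ℝ → ℝ → ℝ} (hζ : ∀ z₁ z₂, ζ z₁ z₂ = (z₂ - z₁ - β) / (g z₂ - g z₁))
    {M : Set (ℝ × ℝ)} (hM : M = {p ∈ D | ∀ p' ∈ D, ζ p'.1 p'.2 ≤ ζ p.1 p.2})
    {ψ : ℝ → ℝ → ℝ} (hψ : ∀ x y, ψ x y = ∫ s in x..y, (1 - deriv g s / deriv g y))
    {ι : ℝ → ℝ} (hι : ∀ u, ι u = sInf {z : ℝ | z ∈ Icc 0 a ∧ deriv g z ≤ u})
    {φ : ℝ → ℝ} (hφ : ∀ x, φ x = ψ (ι (deriv g x)) x) :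
    ∃ z₂ : ℝ, a < z₂ ∧ φ z₂ = β ∧ (∀ w : ℝ, a < w → φ w = β → w = z₂) ∧
      M = {(ι (deriv g z₂), z₂)} := by
  have hdg : deriv g = d := funext fun x => (hg x).deriv
  rw [hdg] at hφ ⊢
  simp only [hdg] at hψ hι
  have hgc : Continuous g := continuous_iff_continuousAt.2 fun t => (hg t).continuousAt
  have hgm : StrictMonoOn g (Ici 0) := by
    refine strictMonoOn_of_deriv_pos (convex_Ici _) hgc.continuousOn fun t ht => ?_
    rw [interior_Ici] at ht
    rw [hdg]
    exact hpos t (le_of_lt ht)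
  have hspec := fun x (hx : a ≤ x) => sInf_sublevel_spec ha hdc hanti hmono hx (hι (d x))
  have hφe : ∀ x, φ x = x - ι (d x) - (g x - g (ι (d x))) / d x := fun x => by
    rw [hφ, hψ, intervalIntegral.integral_sub (by simp)
      ((hdc.div_const _).intervalIntegrable _ _), intervalIntegral.integral_div,
      intervalIntegral.integral_eq_sub_of_hasDerivAt (fun t _ => hg t)
      (hdc.intervalIntegrable _ _)]
    simp
  have hmax : ∀ x, a ≤ x → ∀ z y, 0 ≤ z → z ≤ y → y - z - (g y - g z) / d x ≤ φ x ∧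
      (a < x → y - z - (g y - g z) / d x = φ x → z = ι (d x) ∧ y = x) := by
    intro x hx z y hz hzy
    obtain ⟨-, h1, h2, h3⟩ := hspec x hx
    have := sub_div_deriv_max hg (h1.trans hx) (hpos x (ha.le.trans hx)) h2 h3
      (fun s hs => hmono hx (hx.trans hs.le) hs) hz hzy
    rw [hφe]
    exact ⟨this.1, fun h => this.2 (h1.trans_lt h)⟩
  have hMs : ∀ x, a < x → φ x = β → M = {(ι (d x), x)} := by
    intro x hx hxβ
    obtain ⟨h0, h1, -, -⟩ := hspec x hx.le
    have hdx := hpos x (ha.le.trans hx.le)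
    have hgpos : ∀ z y, 0 ≤ z → z + β ≤ y → 0 < g y - g z := fun z y hz hzy =>
      sub_pos.2 (hgm hz (mem_Ici.2 (by linarith)) (by linarith))
    have hle : ∀ z y, 0 ≤ z → z + β ≤ y → ζ z y ≤ 1 / d x := fun z y hz hzy => by
      rw [hζ, div_le_iff₀ (hgpos z y hz hzy)]
      have := (hmax x hx.le z y hz (by linarith)).1
      rw [hxβ] at this
      rw [one_div_mul_eq_div]; linarith
    have heq : ∀ z y, 0 ≤ z → z + β ≤ y → ζ z y = 1 / d x → z = ι (d x) ∧ y = x :=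
      fun z y hz hzy h => by
        rw [hζ, div_eq_iff (hgpos z y hz hzy).ne', one_div_mul_eq_div] at h
        exact (hmax x hx.le z y hz (by linarith)).2 hx (by linarith)
    have hmem : ι (d x) + β ≤ x := by
      have : 0 < (g x - g (ι (d x))) / d x :=
        div_pos (sub_pos.2 (hgm h0 (ha.le.trans hx.le) (h1.trans_lt hx))) hdx
      have := hφe x
      linarith
    have hat : ζ (ι (d x)) x = 1 / d x := by
      rw [hζ, div_eq_iff (hgpos _ _ h0 hmem).ne', one_div_mul_eq_div]
      linarith [hφe x]
    have hD' : (ι (d x), x) ∈ D := hD ▸ ⟨h0, ha.le.trans hx.le, hmem⟩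
    subst hM
    ext ⟨z, y⟩
    simp only [mem_ofPred_eq, mem_singleton_iff, Prod.mk.injEq]
    constructor
    · rintro ⟨hzD, hz⟩
      rw [hD] at hzD
      have := hz _ hD'
      exact heq z y hzD.1 hzD.2.2 (le_antisymm (hle z y hzD.1 hzD.2.2) (hat ▸ this))
    · rintro ⟨rfl, rfl⟩
      refine ⟨hD', fun p hp => ?_⟩
      rw [hD] at hp
      exact hat ▸ hle _ _ hp.1 hp.2.2
  obtain ⟨X, hXa, hX⟩ : ∃ X, a ≤ X ∧ β ≤ φ X := by
    obtain ⟨X, h1, h2⟩ := ((eventually_ge_atTop a).and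
      (htop.eventually_ge_atTop (g (a + β + 1) - g a))).exists
    refine ⟨X, h1, ?_⟩
    have h3 := (hmax X h1 a (a + β + 1) ha.le (by linarith)).1
    have : (g (a + β + 1) - g a) / d X ≤ 1 := (div_le_one (hpos X (ha.le.trans h1))).2 h2
    linarith
  have hφa : φ a = 0 := by
    obtain ⟨h0, h1, h2, h3⟩ := hspec a le_rfl
    rcases h1.eq_or_lt with h | h
    · rw [hφe, h]; simp
    · exfalso
      have h4 := h3 ((ι (d a) + a) / 2) (by linarith) (by linarith)
      have h5 := hanti ⟨by linarith, by linarith⟩ (right_mem_Icc.2 ha.le)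
        (by linarith : (ι (d a) + a) / 2 < a)
      linarith
  have hstep : ∀ x y, x ∈ Icc a X → y ∈ Icc a X →
      φ y - φ x ≤ (g X - g 0) * |1 / d x - 1 / d y| := by
    intro x y hx hy
    obtain ⟨h0, h1, -, -⟩ := hspec y hy.1
    have h := (hmax x hx.1 (ι (d y)) y h0 (h1.trans hy.1)).1
    have hy0 : 0 ≤ y := ha.le.trans hy.1
    have e : φ y - (y - ι (d y) - (g y - g (ι (d y))) / d x)
        = (g y - g (ι (d y))) * (1 / d x - 1 / d y) := by rw [hφe]; ring
    have m1 : g y ≤ g X := hgm.monotoneOn hy0 (hy0.trans hy.2) hy.2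
    have m2 : g 0 ≤ g (ι (d y)) := hgm.monotoneOn self_mem_Ici h0 h0
    have m3 : g (ι (d y)) ≤ g y := hgm.monotoneOn h0 hy0 (h1.trans hy.1)
    calc φ y - φ x ≤ (g y - g (ι (d y))) * (1 / d x - 1 / d y) := by linarith
      _ ≤ (g y - g (ι (d y))) * |1 / d x - 1 / d y| :=
        mul_le_mul_of_nonneg_left (le_abs_self _) (by linarith)
      _ ≤ _ := mul_le_mul_of_nonneg_right (by linarith) (abs_nonneg _)
  have hcont : ContinuousOn φ (Icc a X) := by
    intro x hx
    have hk : Tendsto (fun y => (g X - g 0) * |1 / d x - 1 / d y|) (nhdsWithin x (Icc a X))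
        (nhds 0) := by
      have hc : ContinuousAt (fun y => (g X - g 0) * |1 / d x - 1 / d y|) x :=
        continuousAt_const.mul (continuousAt_const.sub (continuousAt_const.div hdc.continuousAt
          (hpos x (ha.le.trans hx.1)).ne')).abs
      simpa [ContinuousWithinAt] using hc.continuousWithinAt (s := Icc a X)
    refine tendsto_iff_dist_tendsto_zero.2
      (squeeze_zero' (Eventually.of_forall fun _ => dist_nonneg) ?_ hk)
    filter_upwards [self_mem_nhdsWithin] with y hy
    rw [Real.dist_eq, abs_le]
    have := hstep x y hx hy
    have h' := hstep y x hy hx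
    rw [abs_sub_comm] at h'
    exact ⟨by linarith, this⟩
  obtain ⟨z, hz, hzβ⟩ := intermediate_value_Icc hXa hcont ⟨hφa.le.trans hβ.le, hX⟩
  have haz : a < z := lt_of_le_of_ne hz.1 (by rintro rfl; linarith)
  refine ⟨z, haz, hzβ, fun w hw hwβ => ?_, hMs z haz hzβ⟩
  have := (hMs w hw hwβ).symm.trans (hMs z haz hzβ)
  simpa using congrArg Prod.snd (singleton_injective this)

lemma sqrt_add_pos_and_sub_pos {q σ μ : ℝ} (hq : 0 < q) (hσ : 0 < σ) :
    0 < (√(μ ^ 2 + 2 * q * σ ^ 2) + μ) / σ ^ 2 ∧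
      0 < (√(μ ^ 2 + 2 * q * σ ^ 2) - μ) / σ ^ 2 := by
  have h : |μ| < √(μ ^ 2 + 2 * q * σ ^ 2) := by
    rw [← Real.sqrt_sq_eq_abs]
    exact Real.sqrt_lt_sqrt (sq_nonneg _) (lt_add_of_pos_right _ (by positivity))
  rw [abs_lt] at h
  exact ⟨div_pos (by linarith) (by positivity), div_pos (by linarith) (by positivity)⟩

lemma le_exp_mul_of_log_div_le {r s a : ℝ} (hs : 0 < s) (h : Real.log r / s ≤ a) :
    r ≤ Real.exp (s * a) := by
  rcases le_or_gt r 0 with hr | hr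
  · exact hr.trans (Real.exp_pos _).le
  · rw [← Real.log_le_iff_le_exp hr, mul_comm]
    exact (div_le_iff₀ hs).1 h

lemma hasDerivAt_const_mul_exp_add (A B u v a x : ℝ) :
    HasDerivAt (fun x => A * Real.exp (u * (x - a)) + B * Real.exp (v * (x - a)))
      (A * u * Real.exp (u * (x - a)) + B * v * Real.exp (v * (x - a))) x := by
  have h : ∀ w : ℝ, HasDerivAt (fun x => Real.exp (w * (x - a))) (Real.exp (w * (x - a)) * w) x :=
    fun w => by simpa using (((hasDerivAt_id x).sub_const a).const_mul w).exp
  exact (((h u).const_mul A).add ((h v).const_mul B)).congr_deriv (by ring)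

theorem statement7
    (a q μp μm σp σm : ℝ)
    (ha : 0 < a) (hq : 0 < q) (hσp : 0 < σp) (hσm : 0 < σm)
    (θ1p θ2p θ1m θ2m cm cp : ℝ)
    (hθ1p : θ1p = (Real.sqrt (μp ^ 2 + 2 * q * σp ^ 2) + μp) / σp ^ 2)
    (hθ2p : θ2p = (Real.sqrt (μp ^ 2 + 2 * q * σp ^ 2) - μp) / σp ^ 2)
    (hθ1m : θ1m = (Real.sqrt (μm ^ 2 + 2 * q * σm ^ 2) + μm) / σm ^ 2)
    (hθ2m : θ2m = (Real.sqrt (μm ^ 2 + 2 * q * σm ^ 2) - μm) / σm ^ 2)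
    (hcm : cm = (θ1m - θ1p) / (θ2m + θ1m))
    (hcp : cp = (θ2p - θ2m) / (θ2p + θ1p))
    (gm gp g : ℝ → ℝ)
    (hgm : ∀ x, gm x = if a < x then Real.exp (-θ1p * (x - a))
      else cm * Real.exp (θ2m * (x - a)) + (1 - cm) * Real.exp (-θ1m * (x - a)))
    (hgp : ∀ x, gp x = if a < x then (1 - cp) * Real.exp (θ2p * (x - a)) + cp * Real.exp (-θ1p * (x - a))
      else Real.exp (θ2m * (x - a)))
    (hg : ∀ x, g x = gp x * gm 0 - gm x * gp 0)
    (β : ℝ) (hβ : 0 < β)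
    (Dζ : Set (ℝ × ℝ))
    (hD : Dζ = {p : ℝ × ℝ | 0 ≤ p.1 ∧ 0 ≤ p.2 ∧ p.1 + β ≤ p.2})
    (ζ : ℝ → ℝ → ℝ)
    (hζ : ∀ z₁ z₂, ζ z₁ z₂ = (z₂ - z₁ - β) / (g z₂ - g z₁))
    (Mζ : Set (ℝ × ℝ))
    (hM : Mζ = {p ∈ Dζ | ∀ p' ∈ Dζ, ζ p'.1 p'.2 ≤ ζ p.1 p.2})
    (ψ : ℝ → ℝ → ℝ)
    (hψ : ∀ x y, ψ x y = ∫ s in x..y, (1 - deriv g s / deriv g y))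
    (hμp : 0 < μp) (hμm : 0 < μm)
    (Θ : ℝ)
    (hΘ : Θ = cp * θ1p ^ 2 + (1 - cp) * θ2p ^ 2)
    (a₁ : ℝ)
    (ha₁ : a₁ = 2 * Real.log (θ1m / θ2m) / (θ2m + θ1m))
    (a₂ : ℝ)
    (ha₂ : a₂ = Real.log ((θ2p + θ1m) / (θ2p - θ2m)) / (θ1m + θ2m))
    (a₃ : ℝ)
    (ha₃ : a₃ = Real.log (((1 - cm * cp) * θ1p ^ 2 - (1 - cp) * cm * θ2p ^ 2) / ((1 - cm) * Θ)) / (θ1m + θ2m))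
    (hcase : (0 < cp ∧ 0 < a₂ ∧ a₂ ≤ a ∧ a ≤ a₁) ∨
      (0 < cp ∧ 0 < a₃ ∧ a₃ ≤ a ∧ a ≤ min a₁ a₂) ∨
      (cp ≤ 0 ∧ 0 < Θ ∧ 0 < a₃ ∧ a₃ ≤ a ∧ a ≤ a₁))
    (ι : ℝ → ℝ)
    (hι : ∀ u, ι u = sInf {z : ℝ | z ∈ Set.Icc 0 a ∧ deriv g z ≤ u})
    (φ : ℝ → ℝ)
    (hφ : ∀ x, φ x = ψ (ι (deriv g x)) x)
    :
    ∃ z₂ : ℝ, a < z₂ ∧ φ z₂ = β ∧ (∀ w : ℝ, a < w → φ w = β → w = z₂) ∧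
      Mζ = {(ι (deriv g z₂), z₂)} := by
  obtain ⟨hP1, hP2⟩ := sqrt_add_pos_and_sub_pos (μ := μp) hq hσp
  obtain ⟨hM1, hM2⟩ := sqrt_add_pos_and_sub_pos (μ := μm) hq hσm
  rw [← hθ1p] at hP1
  rw [← hθ2p] at hP2
  rw [← hθ1m] at hM1
  rw [← hθ2m] at hM2
  clear hθ1p hθ2p hθ1m hθ2m
  have hcm' : cm * (θ2m + θ1m) = θ1m - θ1p := by rw [hcm]; field_simp
  have hcp' : cp * (θ2p + θ1p) = θ2p - θ2m := by rw [hcp]; field_simp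
  have hcm1 : 0 < 1 - cm := by
    have : (1 - cm) * (θ2m + θ1m) = θ2m + θ1p := by linarith
    refine pos_of_mul_pos_left (b := θ2m + θ1m) ?_ (by positivity)
    rw [this]; positivity
  have hcp1 : 0 < 1 - cp := by
    have : (1 - cp) * (θ2p + θ1p) = θ1p + θ2m := by linarith
    refine pos_of_mul_pos_left (b := θ2p + θ1p) ?_ (by positivity)
    rw [this]; positivity
  set E₂ := Real.exp (θ2m * (0 - a)) with hE₂
  set E₁ := Real.exp (-θ1m * (0 - a)) with hE₁
  set X := Real.exp ((θ1m + θ2m) * a) with hX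
  have hE₂p : 0 < E₂ := Real.exp_pos _
  have hE₁p : 0 < E₁ := Real.exp_pos _
  have hEX : E₁ = E₂ * X := by
    rw [hE₂, hX, hE₁, ← Real.exp_add]; congr 1; ring
  have hX1 : 1 < X := by rw [hX, Real.one_lt_exp_iff]; positivity
  have hgm0 : gm 0 = cm * E₂ + (1 - cm) * E₁ := by rw [hgm, if_neg (not_lt.2 ha.le)]
  have hgp0 : gp 0 = E₂ := by rw [hgp, if_neg (not_lt.2 ha.le)]
  have hG : 0 < gm 0 := by
    have : gm 0 = E₂ * (1 + (1 - cm) * (X - 1)) := by rw [hgm0, hEX]; ring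
    have : 0 < X - 1 := by linarith
    rw [‹gm 0 = _›]; positivity
  set A := (1 - cp) * gm 0 with hA
  set B := cp * gm 0 - E₂ with hB
  have hAp : 0 < A := mul_pos hcp1 hG
  have hsum : 0 < θ1m + θ2m := by positivity
  have ha₁' : a ≤ a₁ := by
    rcases hcase with h | h | h
    · exact h.2.2.2
    · exact h.2.2.2.trans (min_le_left _ _)
    · exact h.2.2.2.2
  have hΘcase : 0 < Θ → a₃ ≤ a → 0 ≤ A * θ2p ^ 2 + B * θ1p ^ 2 := by
    intro hΘp h3
    rw [ha₃] at h3
    have h := le_exp_mul_of_log_div_le hsum h3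
    rw [div_le_iff₀ (by positivity)] at h
    have e : A * θ2p ^ 2 + B * θ1p ^ 2 = E₂ * (X * ((1 - cm) * Θ) -
        ((1 - cm * cp) * θ1p ^ 2 - (1 - cp) * cm * θ2p ^ 2)) := by
      rw [hA, hB, hgm0, hEX, hΘ]; ring
    rw [e]
    exact mul_nonneg hE₂p.le (sub_nonneg.2 h)
  have hconv : 0 ≤ A * θ2p ^ 2 + B * θ1p ^ 2 := by
    rcases hcase with h | h | h
    · have hd : 0 < θ2p - θ2m := by rw [← hcp']; have := h.1; positivity
      have h2 := h.2.2.1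
      rw [ha₂] at h2
      have h := le_exp_mul_of_log_div_le hsum h2
      rw [div_le_iff₀ hd] at h
      have hBp : 0 ≤ B := by
        have e : B * ((θ2p + θ1p) * (θ2m + θ1m)) =
            E₂ * (θ2m + θ1p) * (X * (θ2p - θ2m) - (θ2p + θ1m)) := by
          rw [hB, hgm0, hEX, hcm, hcp]; field_simp; ring
        refine nonneg_of_mul_nonneg_left (b := (θ2p + θ1p) * (θ2m + θ1m)) ?_ (by positivity)
        rw [e]
        exact mul_nonneg (by positivity) (sub_nonneg.2 h)
      positivity
    · refine hΘcase ?_ h.2.2.1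
      have := h.1
      rw [hΘ]; positivity
    · exact hΘcase h.2.1 h.2.2.2.1
  have hd₁ := fun x => hasDerivAt_const_mul_exp_add A B θ2p (-θ1p) a x
  have hd₂ := fun x => hasDerivAt_const_mul_exp_add ((1 - cm) * E₁) (-((1 - cm) * E₂)) θ2m (-θ1m) a x
  have hdd₁ := fun x => hasDerivAt_const_mul_exp_add (A * θ2p) (B * -θ1p) θ2p (-θ1p) a x
  have hdd₂ := fun x => hasDerivAt_const_mul_exp_add ((1 - cm) * E₁ * θ2m)
    (-((1 - cm) * E₂) * -θ1m) θ2m (-θ1m) a x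
  set d₁ : ℝ → ℝ := fun x => A * θ2p * Real.exp (θ2p * (x - a)) +
    B * -θ1p * Real.exp (-θ1p * (x - a)) with hd₁def
  set d₂ : ℝ → ℝ := fun x => (1 - cm) * E₁ * θ2m * Real.exp (θ2m * (x - a)) +
    -((1 - cm) * E₂) * -θ1m * Real.exp (-θ1m * (x - a)) with hd₂def
  have hda : d₁ a = d₂ a := by
    simp only [hd₁def, hd₂def, sub_self, mul_zero, Real.exp_zero, mul_one, hA, hB, hgm0]
    linear_combination (-(cm * E₂ + (1 - cm) * E₁)) * hcp' + E₂ * hcm'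
  have hgder : ∀ x, HasDerivAt g (if a < x then d₁ x else d₂ x) x := by
    have hge : g = fun x => if a < x then
        A * Real.exp (θ2p * (x - a)) + B * Real.exp (-θ1p * (x - a)) else
        (1 - cm) * E₁ * Real.exp (θ2m * (x - a)) +
          -((1 - cm) * E₂) * Real.exp (-θ1m * (x - a)) := by
      funext x
      rw [hg, hgp0, hgp x, hgm x]
      split_ifs
      · rw [hA, hB]; ring
      · rw [hgm0]; ring
    rw [hge]
    refine hasDerivAt_ite_lt hd₁ hd₂ ?_ hda
    simp only [sub_self, mul_zero, Real.exp_zero, mul_one, hA, hB, hgm0]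
    ring
  have hd₁c : Continuous d₁ := continuous_iff_continuousAt.2 fun x => (hdd₁ x).continuousAt
  have hd₂c : Continuous d₂ := continuous_iff_continuousAt.2 fun x => (hdd₂ x).continuousAt
  have hanti : StrictAntiOn d₂ (Icc 0 a) := by
    refine strictAntiOn_of_deriv_neg (convex_Icc _ _) hd₂c.continuousOn fun x hx => ?_
    rw [interior_Icc] at hx
    rw [(hdd₂ x).deriv]
    have hY : Real.exp ((θ2m + θ1m) * x) < (θ1m / θ2m) ^ 2 := by
      rw [← Real.lt_log_iff_exp_lt (by positivity), Real.log_pow]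
      have : x < 2 * Real.log (θ1m / θ2m) / (θ2m + θ1m) := by linarith [hx.2]
      rw [lt_div_iff₀ (by positivity)] at this
      push_cast
      linarith
    rw [div_pow, lt_div_iff₀ (by positivity)] at hY
    have e1 : E₁ * Real.exp (θ2m * (x - a)) =
        E₂ * Real.exp (-θ1m * (x - a)) * Real.exp ((θ2m + θ1m) * x) := by
      rw [hE₁, hE₂, ← Real.exp_add, ← Real.exp_add, ← Real.exp_add]; congr 1; ring
    have e2 : (1 - cm) * E₁ * θ2m * θ2m * Real.exp (θ2m * (x - a)) +
        -((1 - cm) * E₂) * -θ1m * -θ1m * Real.exp (-θ1m * (x - a)) =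
        (1 - cm) * (E₂ * Real.exp (-θ1m * (x - a))) *
          (Real.exp ((θ2m + θ1m) * x) * θ2m ^ 2 - θ1m ^ 2) := by
      linear_combination (1 - cm) * θ2m ^ 2 * e1
    rw [e2]
    exact mul_neg_of_pos_of_neg (by positivity) (sub_neg.2 hY)
  have hmono : StrictMonoOn d₁ (Ici a) := by
    refine strictMonoOn_of_deriv_pos (convex_Ici _) hd₁c.continuousOn fun x hx => ?_
    rw [interior_Ici, mem_Ioi] at hx
    rw [(hdd₁ x).deriv]
    have hlt : Real.exp (-θ1p * (x - a)) < Real.exp (θ2p * (x - a)) :=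
      Real.exp_lt_exp.2 <|
      mul_lt_mul_of_pos_right (by linarith) (sub_pos.2 hx)
    have := mul_lt_mul_of_pos_left hlt (show 0 < A * θ2p ^ 2 by positivity)
    have := mul_nonneg hconv (Real.exp_pos (-θ1p * (x - a))).le
    linarith
  have hpos₂ : ∀ x, 0 < d₂ x := fun x => by
    have : d₂ x = (1 - cm) * (E₁ * θ2m * Real.exp (θ2m * (x - a)) +
      E₂ * θ1m * Real.exp (-θ1m * (x - a))) := by simp only [hd₂def]; ring
    rw [this]; positivity
  have hEq : EqOn (fun x => if a < x then d₁ x else d₂ x) d₁ (Ici a) := fun x hx => by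
    rcases eq_or_lt_of_le (mem_Ici.1 hx) with rfl | h
    · simp [hda]
    · simp [h]
  refine existsUnique_maximizer_of_strictAnti_strictMono_deriv ha hβ hgder ?_ ?_ ?_ ?_ ?_
    hD hζ hM hψ hι hφ
  · refine Continuous.if_le hd₂c hd₁c continuous_id continuous_const
      (fun x hx => by subst hx; exact hda.symm) |>.congr fun x => ?_
    rcases lt_or_ge a x with h | h
    · simp [h]
    · simp [h, not_lt.2 h]
  · intro x _
    split_ifs with h
    · exact (hda ▸ hpos₂ a : 0 < d₁ a).trans (hmono self_mem_Ici h.le h)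
    · exact hpos₂ x
  · exact hanti.congr fun x hx => (if_neg (not_lt.2 hx.2)).symm
  · exact hmono.congr hEq.symm
  · have hlin : Tendsto (fun x : ℝ => θ2p * (x - a)) atTop atTop :=
      (tendsto_atTop_add_const_right atTop (-a) tendsto_id).const_mul_atTop hP2
    have h := tendsto_atTop_add_const_right atTop (-(|B| * θ1p))
      ((Real.tendsto_exp_atTop.comp hlin).const_mul_atTop (mul_pos hAp hP2))
    refine tendsto_atTop_mono' _ ?_ h
    filter_upwards [eventually_ge_atTop a] with x hx
    refine le_of_le_of_eq ?_ (hEq hx).symm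
    have hle : Real.exp (-θ1p * (x - a)) ≤ 1 := by
      rw [Real.exp_le_one_iff, neg_mul, neg_nonpos]
      exact mul_nonneg hP1.le (sub_nonneg.2 hx)
    have h1 : B * Real.exp (-θ1p * (x - a)) ≤ |B| :=
      (mul_le_mul_of_nonneg_right (le_abs_self B) (Real.exp_pos _).le).trans
        (mul_le_of_le_one_right (abs_nonneg _) hle)
    have := mul_le_mul_of_nonneg_right h1 hP1.le
    simp only [hd₁def, Function.comp_apply]
    linarith
end

section
/- Assume μ₊ ≤ 0 and μ₋ ≤ 0. Then g is convex on (0,∞). -/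
open Real Set Filter

lemma hasDerivAt_exp_mul_sub (A s a x : ℝ) :
    HasDerivAt (fun x => A * Real.exp (s * (x - a))) (A * s * Real.exp (s * (x - a))) x := by
  have h := ((((hasDerivAt_id x).sub_const a).const_mul s).exp).const_mul A
  refine h.congr_deriv ?_
  simp only [id]
  ring

lemma hasDerivAt_exp_add_exp (A B s t a x : ℝ) :
    HasDerivAt (fun x => A * Real.exp (s * (x - a)) + B * Real.exp (-t * (x - a)))
      (A * s * Real.exp (s * (x - a)) + B * -t * Real.exp (-t * (x - a))) x :=
  (hasDerivAt_exp_mul_sub A s a x).add (hasDerivAt_exp_mul_sub B (-t) a x)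

/-- If `A * exp (s * (x - a)) + B * exp (-t * (x - a))` is nonnegative at `x₀`, where `0 ≤ A` and
`0 ≤ t ≤ s`, then its derivative is monotone to the right of `x₀`. -/
lemma monotoneOn_deriv_exp_add_exp {A B s t a x₀ : ℝ} (hA : 0 ≤ A) (ht : 0 ≤ t) (hts : t ≤ s)
    (h₀ : 0 ≤ A * Real.exp (s * (x₀ - a)) + B * Real.exp (-t * (x₀ - a))) :
    MonotoneOn (fun x => A * s * Real.exp (s * (x - a)) + B * -t * Real.exp (-t * (x - a)))
      (Set.Ici x₀) := by
  have hd := hasDerivAt_exp_add_exp (A * s) (B * -t) s t a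
  refine monotoneOn_of_deriv_nonneg (convex_Ici x₀)
    (fun x _ => (hd x).continuousAt.continuousWithinAt)
    (fun x _ => (hd x).differentiableAt.differentiableWithinAt) fun x hx => ?_
  rw [interior_Ici, Set.mem_Ioi] at hx
  rw [(hd x).deriv]
  have e₁ : Real.exp (s * (x - a)) = Real.exp (s * (x₀ - a)) * Real.exp (s * (x - x₀)) := by
    rw [← Real.exp_add]; ring_nf
  have e₂ : Real.exp (-t * (x - a)) = Real.exp (-t * (x₀ - a)) * Real.exp (-t * (x - x₀)) := by
    rw [← Real.exp_add]; ring_nf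
  have hs : 0 ≤ s := ht.trans hts
  have hP : Real.exp (-t * (x - x₀)) ≤ Real.exp (s * (x - x₀)) := by
    apply Real.exp_le_exp.mpr
    nlinarith
  have hu : 0 ≤ A * Real.exp (s * (x₀ - a)) := by positivity
  rw [e₁, e₂]
  have hsq : t ^ 2 * Real.exp (-t * (x - x₀)) ≤ s ^ 2 * Real.exp (s * (x - x₀)) := by
    gcongr
  have h₁ := mul_nonneg hu (sub_nonneg.mpr hsq)
  have h₂ : 0 ≤ (A * Real.exp (s * (x₀ - a)) + B * Real.exp (-t * (x₀ - a))) *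
      (t ^ 2 * Real.exp (-t * (x - x₀))) := by positivity
  linarith

/-- A function obtained by gluing two differentiable functions in a `C¹` way at `a` is convex as
soon as the derivative of each of the two pieces is monotone. -/
lemma convexOn_Ioi_ite {f h f' h' : ℝ → ℝ} {a b : ℝ} (hab : b < a)
    (hf : ∀ x, HasDerivAt f (f' x) x) (hh : ∀ x, HasDerivAt h (h' x) x)
    (hfh : f a = h a) (hfh' : f' a = h' a)
    (mf : MonotoneOn f' (Set.Ioc b a)) (mh : MonotoneOn h' (Set.Ici a)) :
    ConvexOn ℝ (Set.Ioi b) (fun x => if a < x then h x else f x) := by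
  have eqf : ∀ x ≤ a, (if a < x then h x else f x) = f x := fun x hx => if_neg hx.not_gt
  have eqh : ∀ x, a ≤ x → (if a < x then h x else f x) = h x := fun x hx => by
    rcases hx.eq_or_lt with rfl | hx
    · rw [if_neg (lt_irrefl _), hfh]
    · rw [if_pos hx]
  have hd : ∀ x, HasDerivAt (fun x => if a < x then h x else f x)
      (if a < x then h' x else f' x) x := by
    intro x
    rcases lt_trichotomy x a with hx | rfl | hx
    · rw [if_neg hx.not_gt]
      refine (hf x).congr_of_eventuallyEq ?_
      filter_upwards [Iio_mem_nhds hx] with y hy using eqf y (le_of_lt hy)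
    · rw [if_neg (lt_irrefl _), ← hasDerivWithinAt_univ, ← Set.Iic_union_Ici (a := x)]
      refine HasDerivWithinAt.union ?_ ?_
      · exact (hf x).hasDerivWithinAt.congr (fun y hy => eqf y hy) (eqf x le_rfl)
      · rw [hfh']
        exact (hh x).hasDerivWithinAt.congr (fun y hy => eqh y hy) (eqh x le_rfl)
    · rw [if_pos hx]
      refine (hh x).congr_of_eventuallyEq ?_
      filter_upwards [Ioi_mem_nhds hx] with y hy using eqh y (le_of_lt hy)
  refine MonotoneOn.convexOn_of_deriv (convex_Ioi b)
    (fun x _ => (hd x).continuousAt.continuousWithinAt)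
    (fun x _ => (hd x).differentiableAt.differentiableWithinAt) ?_
  intro x hx y hy hxy
  rw [interior_Ioi, Set.mem_Ioi] at hx hy
  rw [(hd x).deriv, (hd y).deriv]
  split_ifs with h₁ h₂ h₂
  · exact mh h₁.le h₂.le hxy
  · exact absurd (h₁.trans_le hxy) h₂
  · calc f' x ≤ f' a := mf ⟨hx, not_lt.mp h₁⟩ ⟨hab, le_rfl⟩ (not_lt.mp h₁)
      _ = h' a := hfh'
      _ ≤ h' y := mh Set.self_mem_Ici h₂.le h₂.le
  · exact mf ⟨hx, not_lt.mp h₁⟩ ⟨hy, not_lt.mp h₂⟩ hxy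

lemma abs_lt_sqrt_sq_add {q σ : ℝ} (μ : ℝ) (hq : 0 < q) (hσ : 0 < σ) :
    |μ| < Real.sqrt (μ ^ 2 + 2 * q * σ ^ 2) := by
  apply Real.lt_sqrt_of_sq_lt
  rw [sq_abs]
  have : 0 < 2 * q * σ ^ 2 := by positivity
  linarith

lemma sqrt_add_div_pos {q σ : ℝ} (μ : ℝ) (hq : 0 < q) (hσ : 0 < σ) :
    0 < (Real.sqrt (μ ^ 2 + 2 * q * σ ^ 2) + μ) / σ ^ 2 :=
  div_pos (by linarith [neg_abs_le μ, abs_lt_sqrt_sq_add μ hq hσ]) (by positivity)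

lemma sqrt_add_div_le_sqrt_sub_div {μ : ℝ} (q σ : ℝ) (hμ : μ ≤ 0) :
    (Real.sqrt (μ ^ 2 + 2 * q * σ ^ 2) + μ) / σ ^ 2 ≤
      (Real.sqrt (μ ^ 2 + 2 * q * σ ^ 2) - μ) / σ ^ 2 := by
  gcongr
  linarith

theorem statement9
    (a q μp μm σp σm : ℝ)
    (ha : 0 < a) (hq : 0 < q) (hσp : 0 < σp) (hσm : 0 < σm)
    (θ1p θ2p θ1m θ2m cm cp : ℝ)
    (hθ1p : θ1p = (Real.sqrt (μp ^ 2 + 2 * q * σp ^ 2) + μp) / σp ^ 2)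
    (hθ2p : θ2p = (Real.sqrt (μp ^ 2 + 2 * q * σp ^ 2) - μp) / σp ^ 2)
    (hθ1m : θ1m = (Real.sqrt (μm ^ 2 + 2 * q * σm ^ 2) + μm) / σm ^ 2)
    (hθ2m : θ2m = (Real.sqrt (μm ^ 2 + 2 * q * σm ^ 2) - μm) / σm ^ 2)
    (hcm : cm = (θ1m - θ1p) / (θ2m + θ1m))
    (hcp : cp = (θ2p - θ2m) / (θ2p + θ1p))
    (gm gp g : ℝ → ℝ)
    (hgm : ∀ x, gm x = if a < x then Real.exp (-θ1p * (x - a))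
      else cm * Real.exp (θ2m * (x - a)) + (1 - cm) * Real.exp (-θ1m * (x - a)))
    (hgp : ∀ x, gp x = if a < x then (1 - cp) * Real.exp (θ2p * (x - a)) + cp * Real.exp (-θ1p * (x - a))
      else Real.exp (θ2m * (x - a)))
    (hg : ∀ x, g x = gp x * gm 0 - gm x * gp 0)
    (hμp : μp ≤ 0) (hμm : μm ≤ 0)
    :
    ConvexOn ℝ (Set.Ioi 0) g := by
  have p1p : 0 < θ1p := hθ1p ▸ sqrt_add_div_pos μp hq hσp
  have p1m : 0 < θ1m := hθ1m ▸ sqrt_add_div_pos μm hq hσm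
  have lep : θ1p ≤ θ2p := by
    rw [hθ1p, hθ2p]; exact sqrt_add_div_le_sqrt_sub_div q σp hμp
  have lem : θ1m ≤ θ2m := by
    rw [hθ1m, hθ2m]; exact sqrt_add_div_le_sqrt_sub_div q σm hμm
  clear hθ1p hθ2p hθ1m hθ2m
  have hm : 0 < θ2m + θ1m := by linarith
  have hp : 0 < θ2p + θ1p := by linarith
  have hcm' : cm * (θ2m + θ1m) = θ1m - θ1p := by rw [hcm, div_mul_cancel₀ _ hm.ne']
  have hcp' : cp * (θ2p + θ1p) = θ2p - θ2m := by rw [hcp, div_mul_cancel₀ _ hp.ne']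
  have hcm1 : 0 < 1 - cm := by
    refine pos_of_mul_pos_left (b := θ2m + θ1m) ?_ hm.le
    linarith
  have hcp1 : 0 < 1 - cp := by
    refine pos_of_mul_pos_left (b := θ2p + θ1p) ?_ hp.le
    linarith
  set E := Real.exp (θ2m * (0 - a)) with hE
  set F := Real.exp (-θ1m * (0 - a)) with hF
  have hgm0 : gm 0 = cm * E + (1 - cm) * F := by rw [hgm, if_neg ha.not_gt]
  have hgp0 : gp 0 = E := by rw [hgp, if_neg ha.not_gt]
  have hE0 : 0 < E := Real.exp_pos _
  have hEF : E ≤ F := by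
    apply Real.exp_le_exp.mpr
    nlinarith
  have hgm0pos : 0 < gm 0 := by
    rw [hgm0]
    nlinarith [mul_nonneg hcm1.le (sub_nonneg.mpr hEF)]
  have hgeq : g = fun x => if a < x then
      (1 - cp) * gm 0 * Real.exp (θ2p * (x - a)) + (cp * gm 0 - E) * Real.exp (-θ1p * (x - a))
      else (1 - cm) * F * Real.exp (θ2m * (x - a)) +
        -((1 - cm) * E) * Real.exp (-θ1m * (x - a)) := by
    funext x
    rw [hg, hgp0, hgm x, hgp x]
    split_ifs
    · ring
    · rw [hgm0]; ring
  rw [hgeq]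
  refine convexOn_Ioi_ite ha (hasDerivAt_exp_add_exp _ _ _ _ _) (hasDerivAt_exp_add_exp _ _ _ _ _)
    ?_ ?_ ?_ ?_
  · simp only [sub_self, mul_zero, Real.exp_zero, hgm0]
    ring
  · simp only [sub_self, mul_zero, Real.exp_zero, hgm0]
    linear_combination -E * hcm' + (cm * E + (1 - cm) * F) * hcp'
  · refine (monotoneOn_deriv_exp_add_exp (x₀ := 0) (by positivity) p1m.le lem ?_).mono
      fun x hx => hx.1.le
    rw [← hE, ← hF]
    exact le_of_eq (by ring)
  · refine monotoneOn_deriv_exp_add_exp (by positivity) p1p.le lep ?_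
    simp only [sub_self, mul_zero, Real.exp_zero, hgm0]
    linarith [mul_nonneg hcm1.le (sub_nonneg.mpr hEF)]
end
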